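/- (Theorem 3.5(a), orthant case.) Fix x ∈ ℝ^n, λ ∈ ℝ^m, μ > 0, ρ > 0 and let s := s(x,λ;μ,ρ), z := z(x,λ;μ,ρ). Then for every h ∈ ℝ^m, writing v := Aᵀh, one has (ρ·∑_{i=1}^n v_i/(s_i+z_i))² ≤ (ρn/μ)·∑_{i=1}^n (z_i/(s_i+z_i))·v_i². (Equivalently, |⟨∇_λη'_μ(x,λ;μ,ρ), h⟩| ≤ √(ρν/μ)·√(hᵀ∇²_λη(x,λ;μ,ρ)h), since ∇_λη'_μ = ρ·A·(1/(s_i+z_i))_i and ∇²_λη = A·diag(z_i/(s_i+z_i))·Aᵀ.) -/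

import Mathlib

open scoped BigOperators

noncomputable def svec {m n : ℕ} (A : Matrix (Fin m) (Fin n) ℝ) (c x : Fin n → ℝ)
    (lam : Fin m → ℝ) (μ ρ : ℝ) : Fin n → ℝ := fun i =>
  (Real.sqrt ((ρ * x i - c i + A.transpose.mulVec lam i) ^ 2 + 4 * ρ * μ)
    - (ρ * x i - c i + A.transpose.mulVec lam i)) / 2

noncomputable def zvec {m n : ℕ} (A : Matrix (Fin m) (Fin n) ℝ) (c x : Fin n → ℝ)
    (lam : Fin m → ℝ) (μ ρ : ℝ) : Fin n → ℝ := fun i =>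
  (Real.sqrt ((ρ * x i - c i + A.transpose.mulVec lam i) ^ 2 + 4 * ρ * μ)
    + (ρ * x i - c i + A.transpose.mulVec lam i)) / 2

noncomputable def phi {n : ℕ} (y : Fin n → ℝ) : ℝ := -∑ i, Real.log (y i)

noncomputable def Lag {m n : ℕ} (A : Matrix (Fin m) (Fin n) ℝ) (b : Fin m → ℝ)
    (c x : Fin n → ℝ) (lam : Fin m → ℝ) (s : Fin n → ℝ) (μ ρ : ℝ) : ℝ :=
  -(ρ * ∑ j, b j * lam j) + ρ * μ * phi s
    + ρ * ∑ i, x i * (A.transpose.mulVec lam i + s i - c i)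
    + (1 / 2) * ∑ i, (A.transpose.mulVec lam i + s i - c i) ^ 2

noncomputable def eta {m n : ℕ} (A : Matrix (Fin m) (Fin n) ℝ) (b : Fin m → ℝ)
    (c x : Fin n → ℝ) (lam : Fin m → ℝ) (μ ρ : ℝ) : ℝ :=
  Lag A b c x lam (svec A c x lam μ ρ) μ ρ

section PositiveParts

variable {m n : ℕ} (A : Matrix (Fin m) (Fin n) ℝ) (c x : Fin n → ℝ) (lam : Fin m → ℝ) {μ ρ : ℝ}

lemma abs_lt_sqrt_sq_add (u : ℝ) {a : ℝ} (ha : 0 < a) : |u| < Real.sqrt (u ^ 2 + a) := by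
  rw [← Real.sqrt_sq_eq_abs]
  exact Real.sqrt_lt_sqrt (sq_nonneg u) (by linarith)

lemma svec_pos (hμ : 0 < μ) (hρ : 0 < ρ) (i : Fin n) : 0 < svec A c x lam μ ρ i := by
  have h := abs_lt_sqrt_sq_add (ρ * x i - c i + A.transpose.mulVec lam i)
    (by positivity : 0 < 4 * ρ * μ)
  unfold svec
  linarith [(abs_lt.mp h).2]

lemma zvec_pos (hμ : 0 < μ) (hρ : 0 < ρ) (i : Fin n) : 0 < zvec A c x lam μ ρ i := by
  have h := abs_lt_sqrt_sq_add (ρ * x i - c i + A.transpose.mulVec lam i)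
    (by positivity : 0 < 4 * ρ * μ)
  unfold zvec
  linarith [(abs_lt.mp h).1]

lemma svec_mul_zvec (hμ : 0 < μ) (hρ : 0 < ρ) (i : Fin n) :
    svec A c x lam μ ρ i * zvec A c x lam μ ρ i = ρ * μ := by
  have h := Real.sq_sqrt
    (by positivity : 0 ≤ (ρ * x i - c i + A.transpose.mulVec lam i) ^ 2 + 4 * ρ * μ)
  unfold svec zvec
  linear_combination h / 4

end PositiveParts

lemma sq_mul_div_add_le {s z μ ρ : ℝ} (v : ℝ) (hs : 0 < s) (hz : 0 < z) (hμ : 0 < μ)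
    (hρ : 0 < ρ) (hsz : s * z = ρ * μ) :
    (ρ * (v / (s + z))) ^ 2 ≤ ρ / μ * (z / (s + z) * v ^ 2) := by
  have key : ρ / μ * (z / (s + z) * v ^ 2) - (ρ * (v / (s + z))) ^ 2 =
      ρ * (v * z) ^ 2 / (μ * (s + z) ^ 2) := by
    field_simp
    linear_combination v ^ 2 * hsz
  have : 0 ≤ ρ * (v * z) ^ 2 / (μ * (s + z) ^ 2) := by positivity
  linarith

/-- Theorem 3.5(a), orthant case: with `v = Aᵀh`,
`(ρ ∑ vᵢ/(sᵢ+zᵢ))² ≤ (ρn/μ) ∑ (zᵢ/(sᵢ+zᵢ)) vᵢ²`. -/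
theorem stmt10 {m n : ℕ} (A : Matrix (Fin m) (Fin n) ℝ) (c : Fin n → ℝ)
    (x : Fin n → ℝ) (lam : Fin m → ℝ) (μ ρ : ℝ) (hμ : 0 < μ) (hρ : 0 < ρ)
    (h : Fin m → ℝ) :
    (ρ * ∑ i, A.transpose.mulVec h i /
        (svec A c x lam μ ρ i + zvec A c x lam μ ρ i)) ^ 2 ≤
      (ρ * n / μ) * ∑ i, (zvec A c x lam μ ρ i /
        (svec A c x lam μ ρ i + zvec A c x lam μ ρ i)) * (A.transpose.mulVec h i) ^ 2 := by
  rw [Finset.mul_sum]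
  refine (sq_sum_le_card_mul_sum_sq (s := Finset.univ)).trans ?_
  rw [Finset.card_univ, Fintype.card_fin, mul_comm ρ (n : ℝ), mul_div_assoc, mul_assoc,
    Finset.mul_sum (a := ρ / μ)]
  gcongr with i
  exact sq_mul_div_add_le _ (svec_pos A c x lam hμ hρ i) (zvec_pos A c x lam hμ hρ i) hμ hρ
    (svec_mul_zvec A c x lam hμ hρ i)
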